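/- Let S be a nonempty string having at least one nonempty border, and suppose per(bord(S)) < per(S). Then every nonempty border b of S satisfies per(b) < per(S); in particular, no border of S has smallest period equal to per(S). (Combinatorial core of the correctness of the border-group array computation, Lemma 4.) -/

import Mathlib

variable {α : Type*}

/-- `v` occurs at (1-indexed) position `i` in `S`. -/
def occursAt (v S : List α) (i : ℕ) : Prop :=
  1 ≤ i ∧ i + v.length ≤ S.length + 1 ∧ (S.drop (i - 1)).take v.length = v

/-- `v` is a cover of `S`: every position of `S` lies within some occurrence of `v`. -/
def isCover (v S : List α) : Prop :=
  ∀ p : ℕ, 1 ≤ p → p ≤ S.length → ∃ i : ℕ, occursAt v S i ∧ i ≤ p ∧ p < i + v.length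

/-- `b` is a border of `S`: a proper prefix and a proper suffix of `S`. -/
def isBorder (b S : List α) : Prop :=
  b.length < S.length ∧ b <+: S ∧ b <:+ S

/-- `p` is a period of `S`: `S[i] = S[i+p]` for all `1 ≤ i ≤ |S| - p` (1-indexed). -/
def isPeriod (p : ℕ) (S : List α) : Prop :=
  1 ≤ p ∧ ∀ i : ℕ, ∀ h : i + p < S.length, S[i]'(by omega) = S[i + p]'h

/-- the smallest period of `S` -/
noncomputable def per (S : List α) : ℕ := sInf {p | isPeriod p S}

/-- `c` is the shortest cover of `S`. -/
def isShortestCover (c S : List α) : Prop :=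
  isCover c S ∧ ∀ c' : List α, isCover c' S → c.length ≤ c'.length

/-- `b` is the longest border of `S`. -/
def isLongestBorder (b S : List α) : Prop :=
  isBorder b S ∧ ∀ b' : List α, isBorder b' S → b'.length ≤ b.length

/-- `r` is the length of the longest common prefix of `X` and `Y`. -/
def isLCPLen (X Y : List α) (r : ℕ) : Prop :=
  r ≤ X.length ∧ r ≤ Y.length ∧ X.take r = Y.take r ∧
  ∀ r' : ℕ, r' ≤ X.length → r' ≤ Y.length → X.take r' = Y.take r' → r' ≤ r

/-- `l` is the length of the longest prefix of `S` having period `p`. -/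
def isLongestPeriodicPrefixLen (p : ℕ) (S : List α) (l : ℕ) : Prop :=
  l ≤ S.length ∧ isPeriod p (S.take l) ∧
  ∀ l' : ℕ, l' ≤ S.length → isPeriod p (S.take l') → l' ≤ l

theorem isPeriod.of_prefix {p : ℕ} {u v : List α} (hp : isPeriod p v) (huv : u <+: v) :
    isPeriod p u := by
  refine ⟨hp.1, fun i hi => ?_⟩
  rw [huv.getElem, huv.getElem]
  exact hp.2 i (hi.trans_le huv.length_le)

theorem isPeriod_per (S : List α) : isPeriod (per S) S :=
  Nat.sInf_mem (s := {p | isPeriod p S})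
    ⟨S.length + 1, by omega, fun i hi => by omega⟩

theorem per_le_of_prefix {u v : List α} (huv : u <+: v) : per u ≤ per v :=
  Nat.sInf_le ((isPeriod_per v).of_prefix huv)

/-- Lemma 4 (combinatorial core): if `S` has a nonempty longest border `B` and
`per B < per S`, then every nonempty border of `S` has smallest period smaller
than `per S`. -/
theorem stmt19 (S : List α) (hS : S ≠ [])
    (B : List α) (hB : isLongestBorder B S) (hBne : B ≠ [])
    (h : per B < per S) :
    ∀ b : List α, isBorder b S → b ≠ [] → per b < per S := by
  intro b hb _
  exact (per_le_of_prefix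
    (List.prefix_of_prefix_length_le hb.2.1 hB.1.2.1 (hB.2 b hb))).trans_lt h
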